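/- Let ℓ > 0 and let α be a real number with α ≠ 0, and define W_{ℓ,α}(ρ) = ρ²/2 − (ℓ^(−α)/α) ρ^α for ρ > 0. Then for all ρ > 0, denoting by W'', W⁽³⁾, W⁽⁴⁾ the second, third and fourth derivatives of W_{ℓ,α}, one has 5 (W⁽³⁾(ρ))² − 3 W''(ρ) W⁽⁴⁾(ρ) = ℓ^(−2α) ρ^(2α−6) P_α(ℓ^α ρ^(2−α)), where P_α(z) = (α−2)(α−1)²(2α−1) + 3(α−3)(α−2)(α−1) z. -/

import Mathlib

/-- The Clairaut potential `W_{ℓ,α}(ρ) = ρ²/2 - (ℓ^(-α)/α) ρ^α`. -/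
noncomputable def W (α ℓ : ℝ) : ℝ → ℝ := fun ρ => ρ ^ 2 / 2 - ℓ ^ (-α) / α * ρ ^ α

/-- The linear polynomial `P_α(z) = (α-2)(α-1)²(2α-1) + 3(α-3)(α-2)(α-1) z`. -/
def P (α z : ℝ) : ℝ :=
  (α - 2) * (α - 1) ^ 2 * (2 * α - 1) + 3 * (α - 3) * (α - 2) * (α - 1) * z

/-- Away from the origin, the derivatives of the Clairaut potential are computed termwise. -/
lemma iteratedDeriv_W (α ℓ : ℝ) (k : ℕ) {x : ℝ} (hx : x ≠ 0) :
    iteratedDeriv k (W α ℓ) x = (Nat.descFactorial 2 k : ℝ) * x ^ (2 - k) / 2 -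
      ℓ ^ (-α) / α * ((descPochhammer ℝ k).eval α * x ^ (α - k)) := by
  have hpow : ContDiffAt ℝ k (fun y : ℝ => y ^ 2 / 2) x := by fun_prop
  have hrpow : ContDiffAt ℝ k (fun y : ℝ => ℓ ^ (-α) / α * y ^ α) x :=
    contDiffAt_const.mul (Real.contDiffAt_rpow_const_of_ne hx)
  have hW : W α ℓ = (fun y : ℝ => y ^ 2 / 2) - fun y : ℝ => ℓ ^ (-α) / α * y ^ α := rfl
  rw [hW, iteratedDeriv_sub hpow hrpow]
  congr 1
  · rw [iteratedDeriv_div_const]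
    simp
  · rw [iteratedDeriv_const_mul_field, iteratedDeriv_eq_iterate, Real.iter_deriv_rpow_const]

/-- The Schaaf test function `5 (W⁽³⁾)² - 3 W'' W⁽⁴⁾` of the Clairaut potential
factors as `ℓ^(-2α) ρ^(2α-6) P_α(ℓ^α ρ^(2-α))`. -/
theorem schaaf_test_eq (α ℓ : ℝ) (hℓ : 0 < ℓ) (hα0 : α ≠ 0) (ρ : ℝ) (hρ : 0 < ρ) :
    5 * (iteratedDeriv 3 (W α ℓ) ρ) ^ 2 -
        3 * iteratedDeriv 2 (W α ℓ) ρ * iteratedDeriv 4 (W α ℓ) ρ =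
      ℓ ^ (-(2 * α)) * ρ ^ (2 * α - 6) * P α (ℓ ^ α * ρ ^ (2 - α)) := by
  have hx := hρ.ne'
  have hc : ℓ ^ (-α) * ℓ ^ α = 1 := by rw [← Real.rpow_add hℓ]; simp
  have hc2 : ℓ ^ (-(2 * α)) = (ℓ ^ (-α)) ^ 2 := by
    rw [pow_two, ← Real.rpow_add hℓ]; ring_nf
  have hshift (n : ℕ) : ρ ^ (α - n) = ρ ^ α / ρ ^ n := Real.rpow_sub_natCast hx α n
  have h6 : ρ ^ (2 * α - 6) = (ρ ^ α) ^ 2 / ρ ^ 6 := by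
    rw [pow_two, ← Real.rpow_add hρ, ← two_mul]
    exact_mod_cast Real.rpow_sub_natCast hx (2 * α) 6
  have h2 : ρ ^ (2 - α) = ρ ^ 2 / ρ ^ α := by
    rw [Real.rpow_sub hρ, Real.rpow_two]
  have hr : ρ ^ α ≠ 0 := (Real.rpow_pos_of_pos hρ α).ne'
  have hl : ℓ ^ α = (ℓ ^ (-α))⁻¹ := eq_inv_of_mul_eq_one_right hc
  have hl0 : ℓ ^ (-α) ≠ 0 := (Real.rpow_pos_of_pos hℓ _).ne'
  simp only [iteratedDeriv_W α ℓ _ hx, hshift, hc2, h6, h2, hl, P]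
  generalize ρ ^ α = r at *
  generalize ℓ ^ (-α) = c at *
  simp [descPochhammer_succ_right, Nat.descFactorial]
  field_simp
  ring
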